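/- arXiv:1805.02001 — 2 statements merged into one kernel-verified Lean document; each statement's English description precedes it below -/
import Mathlib

section
/- Let A and B be isomorphic DG free algebras on n degree-one generators, with differentials determined by crisscross n-tuples (M^1,...,M^n) and (N^1,...,N^n). Then the n²×n block matrix formed by stacking M^1,...,M^n has the same rank as the block matrix formed by stacking N^1,...,N^n. -/
open Matrix

/-- An ordered `n`-tuple `(M^1,…,M^n)` of `n×n` matrices is *crisscross* if
`∑_{l=1}^n [c_j^l r_l^i − c_l^i r_j^l] = 0` for all `i,j`, where `c^i_j` (resp.
`r^i_j`) is the `j`-th column (resp. row) of `M^i`; entrywise this reads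
`∑_l (M^l_{a j} M^i_{l b} − M^i_{a l} M^l_{j b}) = 0` for all `i,j,a,b`. -/
def crisscross {k : Type*} [CommRing k] {n : ℕ}
    (M : Fin n → Matrix (Fin n) (Fin n) k) : Prop :=
  ∀ i j a b : Fin n,
    ∑ l : Fin n, (M l a j * M i l b - M i a l * M l j b) = 0

/-- The `n²×n` matrix obtained by stacking `M^1,…,M^n`. -/
def stack {k : Type*} [CommRing k] {n : ℕ}
    (M : Fin n → Matrix (Fin n) (Fin n) k) : Matrix (Fin n × Fin n) (Fin n) k :=
  fun p b => M p.1 p.2 b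

/-- if the DG free algebras determined by the crisscross tuples
`(M¹,…,Mⁿ)` and `(N¹,…,Nⁿ)` are isomorphic — equivalently, if there is
`A ∈ GLₙ(k)` with `∑_j a_{ij}Nʲ = AᵀMⁱA` for all `i` — then the stacked
`n²×n` matrices `(M¹;…;Mⁿ)` and `(N¹;…;Nⁿ)` have the same rank. -/
theorem stmt3 {k : Type*} [Field k] [CharZero k] [IsAlgClosed k] (n : ℕ)
    (M N : Fin n → Matrix (Fin n) (Fin n) k)
    (hM : crisscross M) (hN : crisscross N)
    (h : ∃ A : Matrix (Fin n) (Fin n) k, IsUnit A.det ∧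
      ∀ i, (∑ j, A i j • N j) = Aᵀ * M i * A) :
    (stack M).rank = (stack N).rank := by
  obtain ⟨A, hA, h⟩ := h
  have key : (kroneckerMap (· * ·) A (1 : Matrix (Fin n) (Fin n) k)) * stack N
      = (kroneckerMap (· * ·) (1 : Matrix (Fin n) (Fin n) k) Aᵀ) * stack M * A := by
    ext ⟨i, a⟩ b
    have h1 := congrFun (congrFun (h i) a) b
    simp only [Matrix.sum_apply, Matrix.smul_apply, smul_eq_mul] at h1
    simp only [Matrix.mul_apply, Fintype.sum_prod_type, kroneckerMap_apply, stack,
      Matrix.one_apply, Matrix.transpose_apply] at h1 ⊢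
    simpa [Finset.sum_ite_eq, ite_mul, mul_ite] using h1
  have d1 : IsUnit (kroneckerMap (· * ·) A (1 : Matrix (Fin n) (Fin n) k)).det := by
    have := det_kronecker A (1 : Matrix (Fin n) (Fin n) k)
    rw [this]
    simpa using hA.pow _
  have d2 : IsUnit (kroneckerMap (· * ·) (1 : Matrix (Fin n) (Fin n) k) Aᵀ).det := by
    have := det_kronecker (1 : Matrix (Fin n) (Fin n) k) Aᵀ
    rw [this]
    simpa using hA.pow _
  have e := congrArg Matrix.rank key
  rw [rank_mul_eq_right_of_isUnit_det _ _ d1, rank_mul_eq_left_of_isUnit_det _ _ hA,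
    rank_mul_eq_right_of_isUnit_det _ _ d2] at e
  exact e.symm
end

section
/- The cochain DG algebra B₄ with underlying graded algebra k⟨x₁,x₂⟩ (generators in degree 1) and differential given by ∂(x₁) = x₁², ∂(x₂) = x₂² satisfies H(B₄) = k: H⁰(B₄) = k and Hⁱ(B₄) = 0 for all i ≥ 1. -/
/-- The degree-`i` homogeneous component of the free algebra `k⟨x_1,...,x_n⟩`
with all generators in degree `1`: the span of the words of length `i`. -/
noncomputable def deg (k : Type*) [CommRing k] (n : ℕ) (i : ℕ) :
    Submodule k (FreeAlgebra k (Fin n)) :=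
  Submodule.span k
    {w | ∃ f : Fin i → Fin n, w = (List.ofFn fun j => FreeAlgebra.ι k (f j)).prod}

/-- Action of the free algebra on pairs: `x_i (p, q) = (x_i p, δ_{ij} p)`. -/
noncomputable def foxAct (k : Type*) [Field k] (j : Fin 2) :
    FreeAlgebra k (Fin 2) →ₐ[k]
      Module.End k (FreeAlgebra k (Fin 2) × FreeAlgebra k (Fin 2)) :=
  FreeAlgebra.lift k fun i =>
    LinearMap.prod
      ((LinearMap.mulLeft k (FreeAlgebra.ι k i)).comp (LinearMap.fst k _ _))
      ((if i = j then (1 : k) else 0) • LinearMap.fst k _ _)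

lemma foxAct_fst {k : Type*} [Field k] (j : Fin 2) (u : FreeAlgebra k (Fin 2)) :
    ∀ p, (foxAct k j u p).1 = u * p.1 := by
  induction u using FreeAlgebra.induction with
  | grade0 r => intro p; simp [Algebra.smul_def]
  | grade1 x => intro p; simp [foxAct]
  | mul a b ha hb => intro p; simp [ha, hb, mul_assoc]
  | add a b ha hb => intro p; simp [ha, hb, add_mul]

lemma foxAct_snd {k : Type*} [Field k] (j i : Fin 2) (u : FreeAlgebra k (Fin 2)) :
    (foxAct k j (FreeAlgebra.ι k i * u) (1, 0)).2 = if i = j then u else 0 := by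
  have h := foxAct_fst j u (1, 0)
  have h2 : ∀ p, (foxAct k j (FreeAlgebra.ι k i) p).2 = (if i = j then (1 : k) else 0) • p.1 := by
    intro p; by_cases hij : i = j <;> simp [foxAct, hij]
  rw [map_mul, Module.End.mul_apply, h2, h]
  split_ifs <;> simp

lemma free_indep {k : Type*} [Field k] (u v : FreeAlgebra k (Fin 2))
    (h : FreeAlgebra.ι k 0 * u + FreeAlgebra.ι k 1 * v = 0) : u = 0 ∧ v = 0 := by
  have key : ∀ j : Fin 2, (if (0 : Fin 2) = j then u else 0) + (if (1 : Fin 2) = j then v else 0)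
      = 0 := by
    intro j
    rw [← foxAct_snd j 0 u, ← foxAct_snd j 1 v, ← Prod.snd_add, ← LinearMap.add_apply,
      ← map_add, h]
    simp
  exact ⟨by simpa using key 0, by simpa using key 1⟩

lemma iota_mem_deg {k : Type*} [Field k] (i : Fin 2) :
    FreeAlgebra.ι k i ∈ deg k 2 1 :=
  Submodule.subset_span ⟨fun _ => i, by simp⟩

lemma deg_succ_decomp {k : Type*} [Field k] (n : ℕ) (a : FreeAlgebra k (Fin 2))
    (ha : a ∈ deg k 2 (n + 1)) : ∃ u ∈ deg k 2 n, ∃ v ∈ deg k 2 n,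
      a = FreeAlgebra.ι k 0 * u + FreeAlgebra.ι k 1 * v := by
  unfold deg at ha
  induction ha using Submodule.span_induction with
  | mem x hx =>
    obtain ⟨f, rfl⟩ := hx
    have hm : (List.ofFn fun j : Fin n => FreeAlgebra.ι k (f j.succ)).prod ∈ deg k 2 n :=
      Submodule.subset_span ⟨fun j => f j.succ, rfl⟩
    rw [List.ofFn_succ, List.prod_cons]
    have h01 : f 0 = 0 ∨ f 0 = 1 := by omega
    rcases h01 with h | h
    · exact ⟨_, hm, 0, Submodule.zero_mem _, by rw [h]; simp⟩
    · exact ⟨0, Submodule.zero_mem _, _, hm, by rw [h]; simp⟩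
  | zero => exact ⟨0, Submodule.zero_mem _, 0, Submodule.zero_mem _, by simp⟩
  | add x y _ _ hx hy =>
    obtain ⟨u, hu, v, hv, rfl⟩ := hx
    obtain ⟨u', hu', v', hv', rfl⟩ := hy
    exact ⟨u + u', Submodule.add_mem _ hu hu', v + v', Submodule.add_mem _ hv hv', by
      rw [mul_add, mul_add]; abel⟩
  | smul c x _ hx =>
    obtain ⟨u, hu, v, hv, rfl⟩ := hx
    exact ⟨c • u, Submodule.smul_mem _ _ hu, c • v, Submodule.smul_mem _ _ hv, by
      simp⟩

/-- the cochain DG algebra `B₄` on `k⟨x₁,x₂⟩` with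
`∂(x₁) = x₁²`, `∂(x₂) = x₂²` has `H⁰ = k` and `Hⁱ = 0` for `i ≥ 1`. -/
theorem stmt8 {k : Type*} [Field k] [CharZero k]
    (d : FreeAlgebra k (Fin 2) →ₗ[k] FreeAlgebra k (Fin 2))
    (hL : ∀ (p : ℕ) (a b : FreeAlgebra k (Fin 2)), a ∈ deg k 2 p →
      d (a * b) = d a * b + ((-1 : k) ^ p) • (a * d b))
    (h1 : d (FreeAlgebra.ι k 0) = FreeAlgebra.ι k 0 * FreeAlgebra.ι k 0)
    (h2 : d (FreeAlgebra.ι k 1) = FreeAlgebra.ι k 1 * FreeAlgebra.ι k 1)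
    (hdd : ∀ x, d (d x) = 0) :
    (∀ a ∈ deg k 2 0, d a = 0) ∧
    (∀ i : ℕ, 1 ≤ i → ∀ a ∈ deg k 2 i, d a = 0 →
      ∃ b ∈ deg k 2 (i - 1), d b = a) := by
  constructor
  · have hone : (1 : FreeAlgebra k (Fin 2)) ∈ deg k 2 0 :=
      Submodule.subset_span ⟨Fin.elim0, by simp⟩
    have hd1 : d 1 = 0 := by simpa using hL 0 1 1 hone
    intro a ha
    unfold deg at ha
    induction ha using Submodule.span_induction with
    | mem x hx => obtain ⟨f, rfl⟩ := hx; simpa using hd1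
    | zero => simp
    | add x y _ _ hx hy => rw [map_add, hx, hy, add_zero]
    | smul c x _ hx => rw [map_smul, hx, smul_zero]
  · intro i hi a ha hda
    obtain ⟨n, rfl⟩ : ∃ n, i = n + 1 := ⟨i - 1, by omega⟩
    obtain ⟨u, hu, v, hv, rfl⟩ := deg_succ_decomp n a ha
    rw [map_add, hL 1 _ u (iota_mem_deg 0), hL 1 _ v (iota_mem_deg 1), h1, h2] at hda
    obtain ⟨e1, e2⟩ := free_indep (FreeAlgebra.ι k 0 * u - d u) (FreeAlgebra.ι k 1 * v - d v) (by
      rw [← hda, pow_one, neg_smul, one_smul, neg_smul, one_smul]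
      noncomm_ring)
    refine ⟨u + v, Submodule.add_mem _ hu hv, ?_⟩
    rw [map_add, ← sub_eq_zero.mp e1, ← sub_eq_zero.mp e2]
end
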